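/- Let X₁, …, Xₙ be independent with regular cdfs F₁, …, Fₙ (densities fᵢ, finite expectations, increasing virtual values ψᵢ) and let rᵢ = ψᵢ⁻¹(0) be the monopoly prices. In the eager second-price auction with reserves (r₁, …, rₙ), bidders with Xⱼ < rⱼ are disregarded; among the remaining bidders the highest one i* wins and pays max(r_{i*}, max{ Xⱼ : j ≠ i*, Xⱼ ≥ rⱼ }). Then the expected revenue of this eager second-price auction with monopoly reserves is at least half the Myerson revenue: R_eager ≥ (1/2) · E[ max(0, maxᵢ ψᵢ(Xᵢ)) ]. -/

import Mathlib

open MeasureTheory Set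

/-- The probability measure of a bidder whose value has density `f` on `[0,∞)`. -/
noncomputable def valueMeasure (f : ℝ → ℝ) : Measure ℝ :=
  (volume.restrict (Ici 0)).withDensity fun x => ENNReal.ofReal (f x)


lemma aux_F_le_one (f F : ℝ → ℝ) (hc : Continuous f) (hpos : ∀ x, 0 ≤ x → 0 < f x)
    (hF : ∀ x, F x = ∫ t in (0:ℝ)..x, f t) (hp : IsProbabilityMeasure (valueMeasure f))
    (x : ℝ) (hx : 0 ≤ x) : F x ≤ 1 := by
  rw [hF, intervalIntegral.integral_of_le hx]
  have h1 : valueMeasure f (Ioc 0 x) ≤ 1 := prob_le_one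
  rw [valueMeasure, withDensity_apply _ measurableSet_Ioc,
    Measure.restrict_restrict measurableSet_Ioc] at h1
  have h2 : Ioc 0 x ∩ Ici (0:ℝ) = Ioc 0 x := by
    ext y; simp; intro a b; exact a.le
  rw [h2, ← ofReal_integral_eq_lintegral_ofReal] at h1
  · simpa using h1
  · exact (hc.integrableOn_Icc).mono_set Ioc_subset_Icc_self
  · filter_upwards [ae_restrict_mem measurableSet_Ioc] with y hy
    exact (hpos y hy.1.le).le

lemma aux_nonneg (f : ℝ → ℝ) : ∀ᵐ x ∂(valueMeasure f), 0 ≤ x := by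
  have : valueMeasure f ≪ volume.restrict (Ici 0) := withDensity_absolutelyContinuous _ _
  exact this.ae_le (ae_restrict_mem measurableSet_Ici)

lemma aux_noatom (f : ℝ → ℝ) (t : ℝ) : ∀ᵐ x ∂(valueMeasure f), x ≠ t := by
  have : valueMeasure f ≪ volume.restrict (Ici 0) := withDensity_absolutelyContinuous _ _
  refine this.ae_le (ae_restrict_of_ae ?_)
  simp [ae_iff]

lemma aux_psi_meas (f F ψ : ℝ → ℝ) (hc : Continuous f)
    (hF : ∀ x, F x = ∫ t in (0:ℝ)..x, f t) (hψ : ∀ x, ψ x = x - (1 - F x) / f x) :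
    Measurable ψ := by
  have hFc : Continuous F := by
    have : F = fun x => ∫ t in (0:ℝ)..x, f t := funext hF
    rw [this]
    exact intervalIntegral.continuous_primitive (fun a b => hc.intervalIntegrable a b) 0
  have : ψ = fun x => x - (1 - F x) / f x := funext hψ
  rw [this]
  exact measurable_id.sub ((measurable_const.sub hFc.measurable).div hc.measurable)

lemma aux_one_dim (f F ψ : ℝ → ℝ) (hc : Continuous f) (hpos : ∀ x, 0 ≤ x → 0 < f x)
    (hF : ∀ x, F x = ∫ t in (0:ℝ)..x, f t) (hψ : ∀ x, ψ x = x - (1 - F x) / f x)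
    (hp : IsProbabilityMeasure (valueMeasure f))
    (t : ℝ) (ht : 0 ≤ t) (hint : IntegrableOn (fun y => ψ y - t) (Ioi t) (valueMeasure f)) :
    ∫ y in Ioi t, (ψ y - t) ∂(valueMeasure f) ≤ 0 := by
  have hFle := aux_F_le_one f F hc hpos hF hp
  have hI : Ioi t ∩ Ici (0:ℝ) = Ioi t := by
    ext y; simp; intro a; linarith
  have hr : (valueMeasure f).restrict (Ioi t)
      = (volume.restrict (Ioi t)).withDensity fun x => ENNReal.ofReal (f x) := by
    rw [valueMeasure, restrict_withDensity measurableSet_Ioi,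
      Measure.restrict_restrict measurableSet_Ioi, hI]
  have hmf : Measurable fun x => ENNReal.ofReal (f x) := hc.measurable.ennreal_ofReal
  have key : EqOn (fun y => (ENNReal.ofReal (f y)).toReal • (ψ y - t))
      (fun y => (y - t) * f y - (1 - F y)) (Ioi t) := by
    intro y hy
    have hy0 : 0 < f y := hpos y (ht.trans (le_of_lt hy))
    simp only [ENNReal.toReal_ofReal hy0.le, smul_eq_mul, hψ]
    field_simp
    ring
  rw [IntegrableOn, hr, integrable_withDensity_iff_integrable_smul' hmf (by simp)] at hint
  rw [hr, integral_withDensity_eq_integral_toReal_smul hmf (by simp),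
    setIntegral_congr_fun measurableSet_Ioi key]
  have hint2 : IntegrableOn (fun y => (y - t) * f y - (1 - F y)) (Ioi t) :=
    IntegrableOn.congr_fun hint key measurableSet_Ioi
  have hlim := intervalIntegral_tendsto_integral_Ioi t hint2 Filter.tendsto_id
  refine le_of_tendsto hlim ?_
  filter_upwards [Filter.eventually_ge_atTop t] with T hT
  have hd : ∀ y, HasDerivAt F (f y) y := by
    intro y
    have : F = fun x => ∫ t in (0:ℝ)..x, f t := funext hF
    rw [this]
    exact intervalIntegral.integral_hasDerivAt_right (hc.intervalIntegrable _ _)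
      (hc.stronglyMeasurableAtFilter _ _) hc.continuousAt
  have hFc : Continuous F := continuous_iff_continuousAt.2 fun y => (hd y).continuousAt
  have : ∫ y in t..T, ((y - t) * f y - (1 - F y))
      = -((T - t) * (1 - F T)) - (-((t - t) * (1 - F t))) := by
    refine intervalIntegral.integral_eq_sub_of_hasDerivAt
      (f := fun y => -((y - t) * (1 - F y))) ?_ ?_
    · intro y _
      have := (((hasDerivAt_id y).sub_const t).mul ((hd y).const_sub 1)).neg
      refine this.congr_deriv ?_
      simp only [id]; ring
    · apply Continuous.intervalIntegrable; fun_prop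
  simp only [id]
  rw [this]
  have h1 : 0 ≤ (T - t) * (1 - F T) :=
    mul_nonneg (by linarith) (by linarith [hFle T (ht.trans hT)])
  linarith

lemma aux_mp {n : ℕ} (μ : Fin n → Measure ℝ) [∀ i, IsProbabilityMeasure (μ i)] (i : Fin n) :
    MeasurePreserving (fun p : (Fin n → ℝ) × ℝ => Function.update p.1 i p.2)
      ((Measure.pi μ).prod (μ i)) (Measure.pi μ) := by
  have hm : Measurable (fun p : (Fin n → ℝ) × ℝ => Function.update p.1 i p.2) := by
    rw [measurable_pi_iff]
    intro j
    by_cases h : j = i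
    · subst h; simpa using measurable_snd
    · simp only [Function.update_of_ne h]
      exact (measurable_pi_apply j).comp measurable_fst
  refine ⟨hm, ?_⟩
  symm
  refine Measure.pi_eq fun s hs => ?_
  rw [Measure.map_apply hm (MeasurableSet.univ_pi hs)]
  have : (fun p : (Fin n → ℝ) × ℝ => Function.update p.1 i p.2) ⁻¹' (univ.pi s)
      = (univ.pi (Function.update s i univ)) ×ˢ (s i) := by
    ext ⟨x, y⟩
    simp only [mem_preimage, mem_pi, mem_univ, true_imp_iff, mem_prod]
    constructor
    · intro h
      refine ⟨fun j => ?_, by simpa using h i⟩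
      by_cases hj : j = i
      · subst hj; simp
      · simpa [hj] using h j
    · rintro ⟨h1, h2⟩ j
      by_cases hj : j = i
      · subst hj; simpa using h2
      · simpa [hj] using h1 j
  rw [this, Measure.prod_prod, Measure.pi_pi, ← Finset.mul_prod_erase _ _ (Finset.mem_univ i),
    ← Finset.mul_prod_erase (a := i) (f := fun j => μ j (s j)) _ (Finset.mem_univ i)]
  have : ∏ x ∈ Finset.univ.erase i, μ x (Function.update s i univ x)
      = ∏ x ∈ Finset.univ.erase i, μ x (s x) := by
    refine Finset.prod_congr rfl fun j hj => ?_
    simp [Finset.ne_of_mem_erase hj]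
  rw [this]
  simp [mul_comm]

/-- The threshold bid of bidder `i`. -/
noncomputable def auxThr {n : ℕ} (r : Fin n → ℝ) (i : Fin n) (x : Fin n → ℝ) : ℝ :=
  Finset.univ.sup' ⟨i, Finset.mem_univ _⟩
    fun j => if j = i then r i else if r j ≤ x j then x j else 0

lemma auxThr_meas {n : ℕ} (r : Fin n → ℝ) (i : Fin n) : Measurable (auxThr r i) := by
  have : auxThr r i = Finset.univ.sup' ⟨i, Finset.mem_univ _⟩
      fun j => fun x : Fin n → ℝ => if j = i then r i else if r j ≤ x j then x j else 0 := by
    ext x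
    have h := Finset.sup'_apply (s := Finset.univ) ⟨i, Finset.mem_univ _⟩
      (fun j => fun x : Fin n → ℝ => if j = i then r i else if r j ≤ x j then x j else 0) x
    exact h.symm
  rw [this]
  refine Finset.measurable_sup' _ fun j _ => ?_
  split_ifs
  · exact measurable_const
  · exact Measurable.ite (measurableSet_le measurable_const (measurable_pi_apply j))
      (measurable_pi_apply j) measurable_const

lemma auxThr_ge {n : ℕ} (r : Fin n → ℝ) (i : Fin n) (x : Fin n → ℝ) : r i ≤ auxThr r i x := by
  have := Finset.le_sup' (fun j => if j = i then r i else if r j ≤ x j then x j else 0)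
    (Finset.mem_univ i)
  simpa [auxThr] using this

lemma auxThr_ge' {n : ℕ} (r : Fin n → ℝ) (i j : Fin n) (x : Fin n → ℝ) (hj : j ≠ i)
    (h : r j ≤ x j) : x j ≤ auxThr r i x := by
  have := Finset.le_sup' (fun j => if j = i then r i else if r j ≤ x j then x j else 0)
    (Finset.mem_univ j)
  simpa [auxThr, hj, h] using this

lemma auxThr_update {n : ℕ} (r : Fin n → ℝ) (i : Fin n) (x : Fin n → ℝ) (y : ℝ) :
    auxThr r i (Function.update x i y) = auxThr r i x := by
  unfold auxThr
  refine Finset.sup'_congr _ rfl fun j _ => ?_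
  by_cases h : j = i <;> simp [h]

/-- **The eager second-price auction with monopoly reserve prices is a 2-approximation of
the Myerson auction.**  Let `X₁,…,Xₙ` be independent with regular cdfs `Fᵢ` (virtual
values `ψᵢ`) and let `rᵢ = ψᵢ⁻¹(0)` be the monopoly prices.  In the eager second-price
auction the bidders with `xⱼ < rⱼ` are disregarded; among the remaining ones the highest
bidder `i* = w x` wins and pays `max(r_{i*}, max{xⱼ : j ≠ i*, xⱼ ≥ rⱼ})`.  The resulting
expected revenue is at least half the Myerson revenue `E[max(0, maxᵢ ψᵢ(Xᵢ))]`. -/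
theorem eager_second_price_monopoly_reserves_half_of_myerson
    (n : ℕ) (hn : 1 ≤ n)
    (F f ψ : Fin n → ℝ → ℝ)
    (hf_cont : ∀ i, Continuous (f i))
    (hf_pos : ∀ i x, 0 ≤ x → 0 < f i x)
    (hF : ∀ i x, F i x = ∫ t in (0:ℝ)..x, f i t)
    (hψ : ∀ i x, ψ i x = x - (1 - F i x) / f i x)
    (hreg : ∀ i, StrictMonoOn (ψ i) (Ici 0))
    (μ : Fin n → Measure ℝ) (hμ : ∀ i, μ i = valueMeasure (f i))
    (hprob : ∀ i, IsProbabilityMeasure (μ i))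
    (hexp : ∀ i, Integrable (fun x => x) (μ i))
    (r : Fin n → ℝ) (hr_nonneg : ∀ i, 0 ≤ r i) (hr_root : ∀ i, ψ i (r i) = 0)
    (w : (Fin n → ℝ) → Fin n)
    (hw_meas : ∀ i, MeasurableSet {x : Fin n → ℝ | w x = i})
    (hw_win : ∀ x : Fin n → ℝ, (Finset.univ.filter fun j => r j ≤ x j).Nonempty →
      w x ∈ (Finset.univ.filter fun j => r j ≤ x j) ∧
        ∀ j ∈ (Finset.univ.filter fun j => r j ≤ x j), x j ≤ x (w x)) :
    (1 / 2 : ℝ) *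
        (∫ x : Fin n → ℝ,
          max 0 (Finset.univ.sup' ⟨⟨0, by omega⟩, Finset.mem_univ _⟩ fun i => ψ i (x i))
          ∂Measure.pi μ)
      ≤ ∫ x : Fin n → ℝ,
          (if hS : (Finset.univ.filter fun j => r j ≤ x j).Nonempty then
            (Finset.univ.filter fun j => r j ≤ x j).sup' hS
              fun j => if j = w x then r (w x) else x j
          else 0)
          ∂Measure.pi μ := by
  classical
  have hpsi_meas : ∀ i, Measurable (ψ i) := fun i =>
    aux_psi_meas (f i) (F i) (ψ i) (hf_cont i) (hF i) (hψ i)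
  have hFle : ∀ i x, 0 ≤ x → F i x ≤ 1 := fun i x hx =>
    aux_F_le_one (f i) (F i) (hf_cont i) (hf_pos i) (hF i) (hμ i ▸ hprob i) x hx
  have hpsi_le : ∀ i x, 0 ≤ x → ψ i x ≤ x := by
    intro i x hx
    rw [hψ]
    have := div_nonneg (sub_nonneg.2 (hFle i x hx)) (hf_pos i x hx).le
    linarith
  have hpsi_nonneg : ∀ i x, r i ≤ x → 0 ≤ ψ i x := by
    intro i x hx
    rw [← hr_root i]
    exact (hreg i).monotoneOn (hr_nonneg i) ((hr_nonneg i).trans hx) hx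
  have hpsi_clear : ∀ i x, 0 ≤ x → 0 < ψ i x → r i ≤ x := by
    intro i x hx h
    by_contra hlt
    push Not at hlt
    have := hreg i hx (hr_nonneg i) hlt
    rw [hr_root] at this
    linarith
  let A : Fin n → Set (Fin n → ℝ) := fun i => {x | w x = i} ∩ {x | r i ≤ x i}
  have hA : ∀ i, MeasurableSet (A i) := fun i =>
    (hw_meas i).inter (measurableSet_le measurable_const (measurable_pi_apply i))
  have hAle : ∀ i x, x ∈ A i → auxThr r i x ≤ x i := by
    rintro i x ⟨h1, h2⟩
    have h1 : w x = i := h1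
    have h2 : r i ≤ x i := h2
    refine Finset.sup'_le _ _ fun j _ => ?_
    split_ifs with a b
    · exact h2
    · have := (hw_win x ⟨j, by simp [b]⟩).2 j (by simp [b])
      rwa [h1] at this
    · exact (hr_nonneg i).trans h2
  have hAlt : ∀ i x, auxThr r i x < x i → x ∈ A i := by
    intro i x h
    have hri : r i ≤ x i := (auxThr_ge r i x).trans h.le
    obtain ⟨h1, h2⟩ := hw_win x ⟨i, by simp [hri]⟩
    refine ⟨?_, hri⟩
    by_contra hne
    have h3 := auxThr_ge' r i (w x) x hne (by simpa using h1)
    have h4 := h2 i (by simp [hri])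
    linarith
  have hcoord : ∀ i, Integrable (fun x : Fin n → ℝ => x i) (Measure.pi μ) := fun i =>
    (measurePreserving_eval μ i).integrable_comp_of_integrable (hexp i)
  let W : Fin n → (Fin n → ℝ) → ℝ := fun i => (A i).indicator fun x => ψ i (x i)
  let P : Fin n → (Fin n → ℝ) → ℝ := fun i => (A i).indicator fun x => auxThr r i x
  have hW : ∀ i, Integrable (W i) (Measure.pi μ) := by
    intro i
    refine (hcoord i).mono
      (((hpsi_meas i).comp (measurable_pi_apply i)).indicator (hA i)).aestronglyMeasurable ?_
    refine Filter.Eventually.of_forall fun x => ?_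
    by_cases hx : x ∈ A i
    · have h0 : 0 ≤ x i := (hr_nonneg i).trans hx.2
      simp only [W, indicator_of_mem hx, Real.norm_eq_abs]
      rw [abs_of_nonneg (hpsi_nonneg i _ hx.2), abs_of_nonneg h0]
      exact hpsi_le i _ h0
    · simp [W, indicator_of_notMem hx]
  have hP : ∀ i, Integrable (P i) (Measure.pi μ) := by
    intro i
    refine (hcoord i).mono
      ((auxThr_meas r i).indicator (hA i)).aestronglyMeasurable ?_
    refine Filter.Eventually.of_forall fun x => ?_
    by_cases hx : x ∈ A i
    · have h0 : 0 ≤ x i := (hr_nonneg i).trans hx.2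
      simp only [P, indicator_of_mem hx, Real.norm_eq_abs]
      rw [abs_of_nonneg ((hr_nonneg i).trans (auxThr_ge r i x)), abs_of_nonneg h0]
      exact hAle i x hx
    · simp [P, indicator_of_notMem hx]
  have hMy : ∀ i, ∫ x, W i x ∂Measure.pi μ ≤ ∫ x, P i x ∂Measure.pi μ := by
    intro i
    rw [← sub_nonpos, ← integral_sub (hW i) (hP i)]
    have hmp := aux_mp μ i
    have hI : Integrable (fun x => W i x - P i x) (Measure.pi μ) := (hW i).sub (hP i)
    have hI2 : Integrable (fun p : (Fin n → ℝ) × ℝ => W i (Function.update p.1 i p.2)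
            - P i (Function.update p.1 i p.2)) ((Measure.pi μ).prod (μ i)) := hmp.integrable_comp_of_integrable hI
    have e1 : ∫ x, (W i x - P i x) ∂Measure.pi μ
        = ∫ p : (Fin n → ℝ) × ℝ, (W i (Function.update p.1 i p.2)
            - P i (Function.update p.1 i p.2)) ∂((Measure.pi μ).prod (μ i)) := by
      conv_lhs => rw [← hmp.map_eq]
      rw [integral_map hmp.measurable.aemeasurable]
      rw [hmp.map_eq]
      exact hI.aestronglyMeasurable
    rw [e1, integral_prod _ hI2]
    refine integral_nonpos_of_ae ?_
    refine Filter.Eventually.of_forall fun x => ?_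
    set t := auxThr r i x with htdef
    have ht : r i ≤ t := auxThr_ge r i x
    have e2 : ∫ y, (W i (Function.update x i y) - P i (Function.update x i y)) ∂μ i
        = ∫ y in Ioi t, (ψ i y - t) ∂μ i := by
      rw [← integral_indicator measurableSet_Ioi]
      refine integral_congr_ae ?_
      have hna : ∀ᵐ y ∂(μ i), y ≠ t := by rw [hμ i]; exact aux_noatom _ t
      filter_upwards [hna] with y hy
      by_cases hyt : t < y
      · have hm : Function.update x i y ∈ A i := hAlt i _ (by simpa [auxThr_update] using hyt)
        rw [indicator_of_mem (mem_Ioi.2 hyt)]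
        simp [W, P, indicator_of_mem hm, auxThr_update, htdef]
      · have hm : Function.update x i y ∉ A i := by
          intro hm
          have := hAle i _ hm
          simp only [auxThr_update, Function.update_self] at this
          exact hyt (lt_of_le_of_ne this (Ne.symm hy))
        have hm2 : y ∉ Ioi t := hyt
        simp [W, P, indicator_of_notMem hm, indicator_of_notMem hm2]
    have hint : IntegrableOn (fun y => ψ i y - t) (Ioi t) (μ i) := by
      refine Integrable.sub ?_ (integrable_const _)
      refine Integrable.mono ((hexp i).integrableOn (s := Ioi t))
        (hpsi_meas i).aestronglyMeasurable ?_
      filter_upwards [ae_restrict_mem measurableSet_Ioi] with y hy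
      have hry : r i ≤ y := ht.trans (le_of_lt hy)
      have h0 : 0 ≤ y := (hr_nonneg i).trans hry
      rw [Real.norm_eq_abs, Real.norm_eq_abs, abs_of_nonneg (hpsi_nonneg i _ hry),
        abs_of_nonneg h0]
      exact hpsi_le i _ h0
    show ∫ y, (W i (Function.update x i y) - P i (Function.update x i y)) ∂μ i ≤ 0
    rw [e2]
    have hp := hprob i
    rw [hμ i] at hint hp ⊢
    exact aux_one_dim (f i) (F i) (ψ i) (hf_cont i) (hf_pos i) (hF i) (hψ i) hp t
      ((hr_nonneg i).trans ht) hint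
  have hPeq : ∀ x : Fin n → ℝ, (if hS : (Finset.univ.filter fun j => r j ≤ x j).Nonempty then
            (Finset.univ.filter fun j => r j ≤ x j).sup' hS
              fun j => if j = w x then r (w x) else x j
          else 0) = ∑ i, P i x := by
    intro x
    split_ifs with hS
    · obtain ⟨h1, h2⟩ := hw_win x hS
      have h1' : r (w x) ≤ x (w x) := by simpa using h1
      rw [Finset.sum_eq_single (w x)]
      · have hm : x ∈ A (w x) := ⟨rfl, h1'⟩
        simp only [P, indicator_of_mem hm]
        apply le_antisymm
        · refine Finset.sup'_le _ _ fun j hj => ?_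
          split_ifs with hjw
          · exact auxThr_ge r _ x
          · exact auxThr_ge' r _ j x hjw (by simpa using hj)
        · have hb : r (w x) ≤ (Finset.univ.filter fun j => r j ≤ x j).sup' hS
              fun j => if j = w x then r (w x) else x j := by
            have := Finset.le_sup' (fun j => if j = w x then r (w x) else x j) h1
            rwa [if_pos rfl] at this
          refine Finset.sup'_le _ _ fun j _ => ?_
          split_ifs with hjw hjr
          · exact hb
          · have := Finset.le_sup' (fun j => if j = w x then r (w x) else x j)
              (show j ∈ Finset.univ.filter fun j => r j ≤ x j by simp [hjr])
            rwa [if_neg hjw] at this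
          · exact (hr_nonneg _).trans hb
      · intro i _ hi
        exact indicator_of_notMem (fun hm => hi (Eq.symm hm.1)) _
      · simp
    · symm
      refine Finset.sum_eq_zero fun i _ => ?_
      exact indicator_of_notMem (fun hm => hS ⟨i, by simpa using hm.2⟩) _
  simp_rw [hPeq]
  have hWs : Integrable (fun x => ∑ i, W i x) (Measure.pi μ) :=
    integrable_finsetSum _ fun i _ => hW i
  have hPs : Integrable (fun x => ∑ i, P i x) (Measure.pi μ) :=
    integrable_finsetSum _ fun i _ => hP i
  have hWP : ∫ x, ∑ i, W i x ∂Measure.pi μ ≤ ∫ x, ∑ i, P i x ∂Measure.pi μ := by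
    rw [integral_finsetSum _ fun i _ => hW i, integral_finsetSum _ fun i _ => hP i]
    exact Finset.sum_le_sum fun i _ => hMy i
  have hnn : ∀ᵐ x ∂Measure.pi μ, ∀ j, 0 ≤ x j := by
    rw [ae_all_iff]
    intro j
    have h : ∀ᵐ y ∂(μ j), 0 ≤ y := by rw [hμ j]; exact aux_nonneg _
    exact (measurePreserving_eval μ j).quasiMeasurePreserving.ae h
  have hW0 : ∀ i x, 0 ≤ W i x := fun i x =>
    indicator_apply_nonneg fun hx => hpsi_nonneg i _ hx.2
  have hP0 : ∀ i x, 0 ≤ P i x := fun i x =>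
    indicator_apply_nonneg fun _ => (hr_nonneg i).trans (auxThr_ge r i x)
  have hfin : ∫ x : Fin n → ℝ,
          max 0 (Finset.univ.sup' ⟨⟨0, by omega⟩, Finset.mem_univ _⟩ fun i => ψ i (x i))
          ∂Measure.pi μ ≤ ∫ x, (∑ i, W i x + ∑ i, P i x) ∂Measure.pi μ := by
    refine integral_mono_of_nonneg (Filter.Eventually.of_forall fun x => le_max_left _ _)
      (hWs.add hPs) ?_
    filter_upwards [hnn] with x hx
    have hs0 : 0 ≤ ∑ i, W i x + ∑ i, P i x :=
      add_nonneg (Finset.sum_nonneg fun i _ => hW0 i x) (Finset.sum_nonneg fun i _ => hP0 i x)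
    refine max_le hs0 (Finset.sup'_le _ _ fun j _ => ?_)
    by_cases hj : 0 < ψ j (x j)
    · have hrj := hpsi_clear j _ (hx j) hj
      obtain ⟨h1, h2⟩ := hw_win x ⟨j, by simp [hrj]⟩
      have h1' : r (w x) ≤ x (w x) := by simpa using h1
      have hm : x ∈ A (w x) := ⟨rfl, h1'⟩
      have hWw := Finset.single_le_sum (fun i _ => hW0 i x) (Finset.mem_univ (w x))
      have hPw := Finset.single_le_sum (fun i _ => hP0 i x) (Finset.mem_univ (w x))
      by_cases hjw : j = w x
      · have : W (w x) x = ψ (w x) (x (w x)) := indicator_of_mem hm _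
        have hp0 := hP0 (w x) x
        rw [hjw]
        linarith
      · have : P (w x) x = auxThr r (w x) x := indicator_of_mem hm _
        have h3 := auxThr_ge' r (w x) j x hjw hrj
        have h4 := hpsi_le j _ (hx j)
        have hw0 := hW0 (w x) x
        linarith
    · linarith
  rw [integral_add hWs hPs] at hfin
  linarith
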